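/- Let α be a CNF formula over variables x_1,…,x_{n−1}, and define the Boolean classifier ρ over {0,1}^n by ρ(x) = 1 iff α(x_1,…,x_{n−1}) = 1 and x_n = 0. Then α is unsatisfiable if and only if ρ is monotone with respect to x_n for the class of positive instances, i.e., if and only if for every x ∈ {0,1}^n with ρ(x) = 1, the instance x[x_n ← 1] obtained from x by setting coordinate x_n to 1 satisfies ρ(x[x_n ← 1]) = 1. -/

import Mathlib

/-- A literal is a variable together with a polarity (`true` for `x_i`,
`false` for `¬x_i`); a clause is a disjunction of literals. -/
abbrev Clause (n : ℕ) := List (Fin n × Bool)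

/-- A CNF formula is a conjunction of clauses. -/
abbrev CNF (n : ℕ) := List (Clause n)

/-- A clause evaluates to `true` on `x` iff some of its literals is satisfied by `x`. -/
def Clause.eval {n : ℕ} (δ : Clause n) (x : Fin n → Bool) : Bool :=
  δ.any fun l => x l.1 == l.2

/-- A CNF formula evaluates to `true` on `x` iff all of its clauses do. -/
def CNF.eval {n : ℕ} (α : CNF n) (x : Fin n → Bool) : Bool :=
  α.all fun δ => Clause.eval δ x

/-- A CNF formula is satisfiable if some instance evaluates it to `true`. -/
def CNF.Satisfiable {n : ℕ} (α : CNF n) : Prop := ∃ x, CNF.eval α x = true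

theorem stmt7 (m : ℕ) (α : CNF m)
    (ρ : (Fin (m + 1) → Bool) → Bool)
    (hρ : ∀ x, ρ x = (CNF.eval α (fun i => x i.castSucc) && !(x (Fin.last m)))) :
    ¬α.Satisfiable ↔
      ∀ x, ρ x = true → ρ (Function.update x (Fin.last m) true) = true := by
  constructor
  · intro hunsat x hx
    rw [hρ, Bool.and_eq_true] at hx
    exact absurd ⟨_, hx.1⟩ hunsat
  · rintro hmono ⟨y, hy⟩
    have hpos : ρ (Fin.snoc (α := fun _ => Bool) y false) = true := by
      simp [hρ, hy]
    have hupd := hmono _ hpos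
    simp [hρ] at hupd
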